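/- Say that a group G belongs to the class 𝒞 if for every finite subset F ⊆ G there exist a pseudolength function ℓ on G, an element t ∈ G, a symmetric G-equivariant generalized combing C of G, and growth bounds γ, ρ : ℕ → ℕ for C with respect to ℓ that are bounded above by polynomials in n, such that: (a) the set tF = {tf : f ∈ F} freely generates a free subsemigroup S of G, and (b) C(1,s) ∩ C(s,g) ∩ C(1,g) ≠ ∅ for every s ∈ S and every g ∈ G. Then: if G₁ ∈ 𝒞 and G₂ ∈ 𝒞, the direct product G₁ × G₂ belongs to 𝒞. -/

import Mathlib

open Set

/-- A pseudolength function: nonnegative, symmetric, subadditive. -/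
def IsPseudolength {G : Type*} [Group G] (ℓ : G → ℝ) : Prop :=
  (∀ g : G, 0 ≤ ℓ g) ∧ (∀ g : G, ℓ g⁻¹ = ℓ g) ∧ ∀ g h : G, ℓ (g * h) ≤ ℓ g + ℓ h

/-- The ball of radius `n` with respect to `ℓ`. -/
def Ball {G : Type*} [Group G] (ℓ : G → ℝ) (n : ℕ) : Set G := {g : G | ℓ g ≤ (n : ℝ)}

/-- `γ, ρ` are growth bounds for the generalized combing `C` with respect to `ℓ`. -/
def GrowthBounds {G : Type*} [Group G] (ℓ : G → ℝ) (C : G → G → Set G) (γ ρ : ℕ → ℕ) : Prop :=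
  (∀ (n : ℕ) (g : G), (C 1 g ∩ Ball ℓ n).Finite ∧ (C 1 g ∩ Ball ℓ n).ncard ≤ γ n) ∧
  (∀ n : ℕ, ∀ g ∈ Ball ℓ n, ∀ x ∈ C 1 g, ℓ x ≤ (ρ n : ℝ))

/-- A symmetric generalized combing. -/
def CombingSymm {G : Type*} [Group G] (C : G → G → Set G) : Prop :=
  ∀ x y : G, C x y = C y x

/-- A `G`-equivariant generalized combing. -/
def CombingEquivariant {G : Type*} [Group G] (C : G → G → Set G) : Prop :=
  ∀ g x y : G, C (g * x) (g * y) = (fun a => g * a) '' C x y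

/-- A subset `A` of a group `G` freely generates a free subsemigroup: any two
nonempty products of elements of `A` that are equal in `G` coincide (as lists). -/
def FreelyGeneratesFreeSubsemigroup {G : Type*} [Group G] (A : Set G) : Prop :=
  ∀ l₁ l₂ : List G, l₁ ≠ [] → l₂ ≠ [] → (∀ x ∈ l₁, x ∈ A) → (∀ x ∈ l₂, x ∈ A) →
    l₁.prod = l₂.prod → l₁ = l₂

/-- The class 𝒞 of groups from the paper: for every finite subset `F` there are a
pseudolength function `ℓ`, an element `t`, a symmetric equivariant generalized
combing `C`, and polynomially bounded growth bounds `γ, ρ`, such that `tF` freely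
generates a free subsemigroup `S` and
`C(1,s) ∩ C(s,g) ∩ C(1,g) ≠ ∅` for all `s ∈ S`, `g ∈ G`. -/
def InClassC (G : Type*) [Group G] : Prop :=
  ∀ F : Finset G, ∃ (ℓ : G → ℝ) (t : G) (C : G → G → Set G) (γ ρ : ℕ → ℕ),
    IsPseudolength ℓ ∧ CombingSymm C ∧ CombingEquivariant C ∧
    GrowthBounds ℓ C γ ρ ∧
    (∃ p : Polynomial ℕ, ∀ n : ℕ, γ n ≤ p.eval n) ∧
    (∃ p : Polynomial ℕ, ∀ n : ℕ, ρ n ≤ p.eval n) ∧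
    FreelyGeneratesFreeSubsemigroup ((fun f => t * f) '' (F : Set G)) ∧
    (∀ s ∈ Subsemigroup.closure ((fun f => t * f) '' (F : Set G)), ∀ g : G,
      (C 1 s ∩ C s g ∩ C 1 g).Nonempty)

section

variable {G H : Type*} [Group G] [Group H]

theorem IsPseudolength.prod {ℓ₁ : G → ℝ} {ℓ₂ : H → ℝ} (h₁ : IsPseudolength ℓ₁)
    (h₂ : IsPseudolength ℓ₂) : IsPseudolength fun g : G × H => ℓ₁ g.1 + ℓ₂ g.2 := by
  obtain ⟨hnn₁, hinv₁, hmul₁⟩ := h₁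
  obtain ⟨hnn₂, hinv₂, hmul₂⟩ := h₂
  refine ⟨fun g => add_nonneg (hnn₁ _) (hnn₂ _), fun g => by simp [hinv₁, hinv₂], fun g h => ?_⟩
  have := hmul₁ g.1 h.1
  have := hmul₂ g.2 h.2
  simp only [Prod.fst_mul, Prod.snd_mul]
  linarith

/-- The coordinatewise product of two generalized combings. -/
def combingProd (C₁ : G → G → Set G) (C₂ : H → H → Set H) (x y : G × H) : Set (G × H) :=
  C₁ x.1 y.1 ×ˢ C₂ x.2 y.2

theorem CombingSymm.prod {C₁ : G → G → Set G} {C₂ : H → H → Set H} (h₁ : CombingSymm C₁)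
    (h₂ : CombingSymm C₂) : CombingSymm (combingProd C₁ C₂) := fun x y => by
  rw [combingProd, combingProd, h₁, h₂]

theorem CombingEquivariant.prod {C₁ : G → G → Set G} {C₂ : H → H → Set H}
    (h₁ : CombingEquivariant C₁) (h₂ : CombingEquivariant C₂) :
    CombingEquivariant (combingProd C₁ C₂) := fun g x y => by
  simp only [combingProd, Prod.fst_mul, Prod.snd_mul, h₁ g.1, h₂ g.2, Set.prod_image_image_eq]
  rfl

theorem GrowthBounds.prod {ℓ₁ : G → ℝ} {ℓ₂ : H → ℝ} {C₁ : G → G → Set G} {C₂ : H → H → Set H}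
    {γ₁ ρ₁ γ₂ ρ₂ : ℕ → ℕ} (hℓ₁ : IsPseudolength ℓ₁) (hℓ₂ : IsPseudolength ℓ₂)
    (h₁ : GrowthBounds ℓ₁ C₁ γ₁ ρ₁) (h₂ : GrowthBounds ℓ₂ C₂ γ₂ ρ₂) :
    GrowthBounds (fun g : G × H => ℓ₁ g.1 + ℓ₂ g.2) (combingProd C₁ C₂)
      (fun n => γ₁ n * γ₂ n) (fun n => ρ₁ n + ρ₂ n) := by
  have hball : ∀ (n : ℕ) (g : G × H), g ∈ Ball (fun g : G × H => ℓ₁ g.1 + ℓ₂ g.2) n →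
      g.1 ∈ Ball ℓ₁ n ∧ g.2 ∈ Ball ℓ₂ n := fun n g hg => by
    have := hℓ₁.1 g.1
    have := hℓ₂.1 g.2
    simp only [Ball, Set.mem_ofPred_eq] at hg ⊢
    constructor <;> linarith
  refine ⟨fun n g => ?_, fun n g hg x hx => ?_⟩
  · have hsub : combingProd C₁ C₂ 1 g ∩ Ball (fun g : G × H => ℓ₁ g.1 + ℓ₂ g.2) n ⊆
        (C₁ 1 g.1 ∩ Ball ℓ₁ n) ×ˢ (C₂ 1 g.2 ∩ Ball ℓ₂ n) := fun x hx =>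
      ⟨⟨hx.1.1, (hball n x hx.2).1⟩, ⟨hx.1.2, (hball n x hx.2).2⟩⟩
    obtain ⟨hfin₁, hcard₁⟩ := h₁.1 n g.1
    obtain ⟨hfin₂, hcard₂⟩ := h₂.1 n g.2
    refine ⟨(hfin₁.prod hfin₂).subset hsub,
      (Set.ncard_le_ncard hsub (hfin₁.prod hfin₂)).trans ?_⟩
    rw [Set.ncard_prod]
    exact Nat.mul_le_mul hcard₁ hcard₂
  · push_cast
    exact add_le_add (h₁.2 n g.1 (hball n g hg).1 x.1 hx.1) (h₂.2 n g.2 (hball n g hg).2 x.2 hx.2)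

/-- A free generating set is obtained from any set whose coordinate projections lie in free
generating sets. -/
theorem FreelyGeneratesFreeSubsemigroup.of_prod {A : Set (G × H)} {A₁ : Set G} {A₂ : Set H}
    (h₁ : FreelyGeneratesFreeSubsemigroup A₁) (h₂ : FreelyGeneratesFreeSubsemigroup A₂)
    (hA : A ⊆ A₁ ×ˢ A₂) : FreelyGeneratesFreeSubsemigroup A := by
  intro l m hl hm hlA hmA hprod
  have hfst : l.map Prod.fst = m.map Prod.fst := by
    refine h₁ _ _ (by simpa using hl) (by simpa using hm)
      (List.forall_mem_map.2 fun x hx => (hA (hlA x hx)).1)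
      (List.forall_mem_map.2 fun x hx => (hA (hmA x hx)).1) ?_
    simpa only [map_list_prod, MonoidHom.coe_fst] using congrArg (MonoidHom.fst G H) hprod
  have hsnd : l.map Prod.snd = m.map Prod.snd := by
    refine h₂ _ _ (by simpa using hl) (by simpa using hm)
      (List.forall_mem_map.2 fun x hx => (hA (hlA x hx)).2)
      (List.forall_mem_map.2 fun x hx => (hA (hmA x hx)).2) ?_
    simpa only [map_list_prod, MonoidHom.coe_snd] using congrArg (MonoidHom.snd G H) hprod
  exact (List.zip_of_prod hfst hsnd).trans (List.zip_of_prod rfl rfl).symm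

theorem Subsemigroup.closure_le_prod_closure {A : Set (G × H)} {A₁ : Set G} {A₂ : Set H}
    (hA : A ⊆ A₁ ×ˢ A₂) :
    Subsemigroup.closure A ≤ (Subsemigroup.closure A₁).prod (Subsemigroup.closure A₂) :=
  Subsemigroup.closure_le.2 fun _ hx =>
    ⟨Subsemigroup.subset_closure (hA hx).1, Subsemigroup.subset_closure (hA hx).2⟩

end

theorem classC_prod {G₁ G₂ : Type*} [Group G₁] [Group G₂]
    (h₁ : InClassC G₁) (h₂ : InClassC G₂) : InClassC (G₁ × G₂) := by
  classical
  intro F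
  obtain ⟨ℓ₁, t₁, C₁, γ₁, ρ₁, hℓ₁, hs₁, he₁, hg₁, ⟨p₁, hp₁⟩, ⟨q₁, hq₁⟩, hfree₁, hC₁⟩ :=
    h₁ (F.image Prod.fst)
  obtain ⟨ℓ₂, t₂, C₂, γ₂, ρ₂, hℓ₂, hs₂, he₂, hg₂, ⟨p₂, hp₂⟩, ⟨q₂, hq₂⟩, hfree₂, hC₂⟩ :=
    h₂ (F.image Prod.snd)
  have hsub : (fun f => (t₁, t₂) * f) '' (F : Set (G₁ × G₂)) ⊆
      ((fun f => t₁ * f) '' (F.image Prod.fst : Set G₁)) ×ˢ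
        ((fun f => t₂ * f) '' (F.image Prod.snd : Set G₂)) := by
    rintro _ ⟨f, hf, rfl⟩
    exact ⟨⟨f.1, Finset.mem_coe.2 (Finset.mem_image_of_mem _ hf), rfl⟩,
      ⟨f.2, Finset.mem_coe.2 (Finset.mem_image_of_mem _ hf), rfl⟩⟩
  refine ⟨_, (t₁, t₂), combingProd C₁ C₂, _, _, hℓ₁.prod hℓ₂, hs₁.prod hs₂, he₁.prod he₂,
    hg₁.prod hℓ₁ hℓ₂ hg₂, ⟨p₁ * p₂, fun n => ?_⟩, ⟨q₁ + q₂, fun n => ?_⟩,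
    hfree₁.of_prod hfree₂ hsub, fun s hs g => ?_⟩
  · rw [Polynomial.eval_mul]
    exact Nat.mul_le_mul (hp₁ n) (hp₂ n)
  · rw [Polynomial.eval_add]
    exact Nat.add_le_add (hq₁ n) (hq₂ n)
  · obtain ⟨hs₁, hs₂⟩ := Subsemigroup.closure_le_prod_closure hsub hs
    obtain ⟨x, ⟨hx1s, hxsg⟩, hx1g⟩ := hC₁ s.1 hs₁ g.1
    obtain ⟨y, ⟨hy1s, hysg⟩, hy1g⟩ := hC₂ s.2 hs₂ g.2
    exact ⟨(x, y), ⟨⟨hx1s, hy1s⟩, ⟨hxsg, hysg⟩⟩, ⟨hx1g, hy1g⟩⟩
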